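/- Let (X, {e_i^c}, {ε_J}, {ε*_J}) be an A_n epsilon system (total-function model). For every interval [s,t] with s ≥ 2, every x ∈ X with ε_{s−1}(x) ≠ 0, and every c ∈ ℂˣ: ε_{[s,t]}(e_{s−1}^c x) = c·ε_{[s,t]}(x) + (1−c) ε_{[s−1,t]}(x)/ε_{s−1}(x), and ε*_{[s,t]}(e_{s−1}^c x) = ε*_{[s,t]}(x) + (c−1) ε*_{[s−1,t]}(x)/ε_{s−1}(x). -/

import Mathlib

open Finset

namespace EpsSys

/-- All partitions of the interval `[s,t]` into consecutive blocks `(a,b)` (meaning `{a,…,b}`),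
listed left to right; the first argument is fuel. For the empty interval (`t < s`) the only
partition is the empty list. -/
def partitionsAux : ℕ → ℕ → ℕ → List (List (ℕ × ℕ))
  | 0, _, _ => [[]]
  | fuel+1, s, t =>
    if t < s then [[]]
    else (List.range (t + 1 - s)).flatMap fun d =>
      (partitionsAux fuel (s + d + 1) t).map (fun P => (s, s + d) :: P)

/-- The list of all partitions of the interval `[s,t]`. -/
def partitions (s t : ℕ) : List (List (ℕ × ℕ)) :=
  partitionsAux (t + 1 - s) s t

variable {A : Type*} [CommRing A]

/-- `ε_P`: the product of `ε` over the blocks of a partition `P`. -/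
def epsP (eps : ℕ → ℕ → A) (P : List (ℕ × ℕ)) : A :=
  (P.map fun p => eps p.1 p.2).prod

/-- The partition sum `ε*_{[s,t]} = Σ_{P partition of [s,t]} (−1)^{|J| − l(P)} ε_P`.
For the empty interval (`t < s`) this equals `1`. -/
def epsStar (eps : ℕ → ℕ → A) (s t : ℕ) : A :=
  ((partitions s t).map fun P => (-1 : A) ^ (t + 1 - s - P.length) * epsP eps P).sum

/-- Extension of a family indexed by intervals by the convention `ε_∅ = 1`. -/
def epsE (eps : ℕ → ℕ → A) (s t : ℕ) : A :=
  if t < s then 1 else eps s t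

end EpsSys


namespace EpsSys

/-- An `A_n` epsilon system on a set `X` (total-function model): maps `e_i^c : X → X`
(`act i c`) for `i ∈ {1,…,n}`, `c ∈ ℂˣ`, together with functions `ε_J = eps s t` and
`ε*_J = star s t` for every interval `J = [s,t]` (`1 ≤ s ≤ t ≤ n`), satisfying
`ε*_{[i,i]} = ε_{[i,i]}` and the axioms (E1), (E2), (E3). -/
structure EpsSystem (n : ℕ) (X : Type*) where
  /-- the action `e_i^c` -/
  act : ℕ → ℂˣ → X → X
  /-- `ε_{[s,t]}` -/
  eps : ℕ → ℕ → X → ℂ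
  /-- `ε*_{[s,t]}` -/
  star : ℕ → ℕ → X → ℂ
  /-- `ε*_{[i,i]} = ε_{[i,i]}` -/
  star_diag : ∀ i x, 1 ≤ i → i ≤ n → star i i x = eps i i x
  /-- (E1), first half: `ε_J(e_s^c x) = c⁻¹ ε_J(x)` -/
  eps_act_eq : ∀ s t i (c : ℂˣ) x, 1 ≤ s → s ≤ t → t ≤ n → i = s →
    eps s t (act i c x) = (c : ℂ)⁻¹ * eps s t x
  /-- (E1), second half: `ε_J(e_i^c x) = ε_J(x)` for `i ∉ {s−1, s, t+1}` -/
  eps_act_inv : ∀ s t i (c : ℂˣ) x, 1 ≤ s → s ≤ t → t ≤ n → 1 ≤ i → i ≤ n →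
    i ≠ s - 1 → i ≠ s → i ≠ t + 1 →
    eps s t (act i c x) = eps s t x
  /-- (E2), first half: `ε*_J(e_t^c x) = c⁻¹ ε*_J(x)` -/
  star_act_eq : ∀ s t i (c : ℂˣ) x, 1 ≤ s → s ≤ t → t ≤ n → i = t →
    star s t (act i c x) = (c : ℂ)⁻¹ * star s t x
  /-- (E2), second half: `ε*_J(e_i^c x) = ε*_J(x)` for `i ∉ {s−1, t, t+1}` -/
  star_act_inv : ∀ s t i (c : ℂˣ) x, 1 ≤ s → s ≤ t → t ≤ n → 1 ≤ i → i ≤ n →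
    i ≠ s - 1 → i ≠ t → i ≠ t + 1 →
    star s t (act i c x) = star s t x
  /-- (E3): `ε*_J = Σ_{P partition of J} (−1)^{|J|−l(P)} ε_P` -/
  star_partition : ∀ s t x, 1 ≤ s → s ≤ t → t ≤ n →
    star s t x = EpsSys.epsStar (fun a b => eps a b x) s t

end EpsSys

namespace EpsSys

lemma partitionsAux_congr_fuel (t : ℕ) : ∀ (f g s : ℕ), t + 1 - s ≤ f → t + 1 - s ≤ g →
    partitionsAux f s t = partitionsAux g s t
  | 0, 0, _, _, _ => rfl
  | 0, g + 1, s, hf, _ => by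
    have h : t < s := by omega
    simp [partitionsAux, h]
  | f + 1, 0, s, _, hg => by
    have h : t < s := by omega
    simp [partitionsAux, h]
  | f + 1, g + 1, s, hf, hg => by
    have h (d : ℕ) : partitionsAux f (s + d + 1) t = partitionsAux g (s + d + 1) t :=
      partitionsAux_congr_fuel t f g _ (by omega) (by omega)
    simp only [partitionsAux, h]

lemma partitions_of_lt {s t : ℕ} (h : t < s) : partitions s t = [[]] := by
  have h0 : t + 1 - s = 0 := by omega
  simp [partitions, h0, partitionsAux]

lemma partitions_of_le {s t : ℕ} (h : s ≤ t) :
    partitions s t = (List.range (t + 1 - s)).flatMap fun d =>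
      (partitions (s + d + 1) t).map (fun P => (s, s + d) :: P) := by
  have hfuel (d : ℕ) : partitionsAux (t - s) (s + d + 1) t = partitions (s + d + 1) t :=
    partitionsAux_congr_fuel t _ _ _ (by omega) le_rfl
  have hlen : t + 1 - s = (t - s) + 1 := by omega
  rw [partitions, hlen, partitionsAux, ← hlen, if_neg (by omega)]
  simp only [hfuel]

lemma length_le_of_mem_partitionsAux (t : ℕ) : ∀ (f s : ℕ), ∀ P ∈ partitionsAux f s t,
    P.length ≤ t + 1 - s
  | 0, s, P, hP => by simp_all [partitionsAux]
  | f + 1, s, P, hP => by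
    rw [partitionsAux] at hP
    split_ifs at hP with h
    · simp_all
    · simp only [List.mem_flatMap, List.mem_range, List.mem_map] at hP
      obtain ⟨d, hd, Q, hQ, rfl⟩ := hP
      have := length_le_of_mem_partitionsAux t f _ Q hQ
      simp only [List.length_cons]
      omega

lemma epsStar_of_lt {A : Type*} [CommRing A] (eps : ℕ → ℕ → A) {s t : ℕ} (h : t < s) :
    epsStar eps s t = 1 := by
  have h0 : t + 1 - s = 0 := by omega
  simp [epsStar, h0, partitions_of_lt h, epsP]

/-- Expansion of the partition sum along the first block. -/
lemma epsStar_eq_sum {A : Type*} [CommRing A] (eps : ℕ → ℕ → A) {s t : ℕ} (h : s ≤ t) :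
    epsStar eps s t = ∑ d ∈ range (t + 1 - s),
      (-1) ^ d * eps s (s + d) * epsStar eps (s + d + 1) t := by
  have key : ∀ d ∈ range (t + 1 - s),
      (((partitions (s + d + 1) t).map (fun P => (s, s + d) :: P)).map fun P =>
        (-1 : A) ^ (t + 1 - s - P.length) * epsP eps P).sum =
      (-1) ^ d * eps s (s + d) * epsStar eps (s + d + 1) t := by
    intro d hd
    rw [epsStar, ← List.sum_map_mul_left, List.map_map]
    refine congrArg List.sum (List.map_congr_left fun P hP => ?_)
    have hlen := length_le_of_mem_partitionsAux t _ _ P hP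
    have hexp : t + 1 - s - (P.length + 1) = d + (t + 1 - (s + d + 1) - P.length) := by
      rw [mem_range] at hd
      omega
    simp only [Function.comp_apply, List.length_cons, hexp, pow_add, epsP, List.map_cons,
      List.prod_cons]
    ring
  rw [← sum_congr rfl key, epsStar, partitions_of_le h, List.map_flatMap, List.flatMap,
    List.sum_flatten, List.map_map]
  rfl

/-- Expansion along the first block, with the block `[r, r]` split off. -/
lemma epsStar_eq_add_sum {A : Type*} [CommRing A] (eps : ℕ → ℕ → A) (r m : ℕ) :
    epsStar eps r (r + 1 + m) = eps r r * epsStar eps (r + 1) (r + 1 + m) -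
      ∑ d ∈ range (m + 1), (-1) ^ d * eps r (r + 1 + d) *
        epsStar eps (r + 1 + d + 1) (r + 1 + m) := by
  have hlen : r + 1 + m + 1 - r = (m + 1) + 1 := by omega
  rw [epsStar_eq_sum eps (by omega), hlen, sum_range_succ', sub_eq_add_neg, add_comm,
    ← sum_neg_distrib]
  congr 1
  · simp
  · refine sum_congr rfl fun d _ => ?_
    rw [show r + (d + 1) = r + 1 + d by omega]
    ring

namespace EpsSystem

variable {n : ℕ} {X : Type*} (S : EpsSystem n X)

lemma epsStar_act_of_lt {r k t : ℕ} (hr : 1 ≤ r) (hk : r + 1 < k) (hrt : r < t) (ht : t ≤ n)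
    (x : X) (c : ℂˣ) :
    epsStar (fun a b => S.eps a b (S.act r c x)) k t = epsStar (fun a b => S.eps a b x) k t := by
  rcases lt_or_ge t k with h | h
  · rw [epsStar_of_lt _ h, epsStar_of_lt _ h]
  · rw [← S.star_partition k t _ (by omega) h ht, ← S.star_partition k t _ (by omega) h ht]
    exact S.star_act_inv k t r c x (by omega) h ht hr (by omega) (by omega) (by omega) (by omega)

lemma star_act_pred {r m : ℕ} (hr : 1 ≤ r) (ht : r + 1 + m ≤ n) {x : X}
    (hx : S.eps r r x ≠ 0) (c : ℂˣ) :
    S.star (r + 1) (r + 1 + m) (S.act r c x) = S.star (r + 1) (r + 1 + m) x +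
      ((c : ℂ) - 1) * S.star r (r + 1 + m) x / S.eps r r x := by
  have hy := epsStar_eq_add_sum (fun a b => S.eps a b (S.act r c x)) r m
  have hz := epsStar_eq_add_sum (fun a b => S.eps a b x) r m
  have hsum : ∑ d ∈ range (m + 1), (-1) ^ d * S.eps r (r + 1 + d) (S.act r c x) *
        epsStar (fun a b => S.eps a b (S.act r c x)) (r + 1 + d + 1) (r + 1 + m) =
      (c : ℂ)⁻¹ * ∑ d ∈ range (m + 1), (-1) ^ d * S.eps r (r + 1 + d) x *
        epsStar (fun a b => S.eps a b x) (r + 1 + d + 1) (r + 1 + m) := by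
    rw [mul_sum]
    refine sum_congr rfl fun d hd => ?_
    rw [mem_range] at hd
    rw [S.epsStar_act_of_lt hr (by omega) (by omega) ht,
      S.eps_act_eq r (r + 1 + d) r c x hr (by omega) (by omega) rfl]
    ring
  rw [hsum, S.eps_act_eq r r r c x hr le_rfl (by omega) rfl,
    ← S.star_partition r _ _ hr (by omega) ht,
    ← S.star_partition (r + 1) _ _ (by omega) (by omega) ht,
    S.star_act_inv r (r + 1 + m) r c x hr (by omega) ht hr (by omega) (by omega) (by omega)
      (by omega)] at hy
  rw [← S.star_partition r _ _ hr (by omega) ht,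
    ← S.star_partition (r + 1) _ _ (by omega) (by omega) ht] at hz
  have hc : (c : ℂ) ≠ 0 := c.ne_zero
  field_simp at hy ⊢
  linear_combination -hy + hz

lemma eps_act_pred {r : ℕ} (hr : 1 ≤ r) {x : X} (hx : S.eps r r x ≠ 0) (c : ℂˣ) (m : ℕ)
    (ht : r + 1 + m ≤ n) :
    S.eps (r + 1) (r + 1 + m) (S.act r c x) = (c : ℂ) * S.eps (r + 1) (r + 1 + m) x +
      (1 - (c : ℂ)) * S.eps r (r + 1 + m) x / S.eps r r x := by
  induction m using Nat.strong_induction_on with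
  | _ m ih =>
    have hlen : r + 1 + m + 1 - (r + 1) = m + 1 := by omega
    have hstar := S.star_act_pred hr ht hx c
    have hz := epsStar_eq_add_sum (fun a b => S.eps a b x) r m
    have hy := epsStar_eq_sum (fun a b => S.eps a b (S.act r c x))
      (show r + 1 ≤ r + 1 + m by omega)
    have hw := epsStar_eq_sum (fun a b => S.eps a b x) (show r + 1 ≤ r + 1 + m by omega)
    rw [hlen] at hy hw
    rw [← S.star_partition r _ _ hr (by omega) ht,
      ← S.star_partition (r + 1) _ _ (by omega) (by omega) ht] at hz
    rw [← S.star_partition (r + 1) _ _ (by omega) (by omega) ht] at hy hw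
    rw [sum_range_succ, epsStar_of_lt _ (by omega)] at hz hy hw
    have hsum : ∑ d ∈ range m, (-1) ^ d * S.eps (r + 1) (r + 1 + d) (S.act r c x) *
          epsStar (fun a b => S.eps a b (S.act r c x)) (r + 1 + d + 1) (r + 1 + m) =
        (c : ℂ) * ∑ d ∈ range m, (-1) ^ d * S.eps (r + 1) (r + 1 + d) x *
          epsStar (fun a b => S.eps a b x) (r + 1 + d + 1) (r + 1 + m) +
        (1 - (c : ℂ)) / S.eps r r x * ∑ d ∈ range m, (-1) ^ d * S.eps r (r + 1 + d) x *
          epsStar (fun a b => S.eps a b x) (r + 1 + d + 1) (r + 1 + m) := by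
      rw [mul_sum, mul_sum, ← sum_add_distrib]
      refine sum_congr rfl fun d hd => ?_
      rw [mem_range] at hd
      rw [S.epsStar_act_of_lt hr (by omega) (by omega) ht, ih d hd (by omega)]
      ring
    rw [hsum] at hy
    have hneg : ((-1 : ℂ) ^ m) ≠ 0 := pow_ne_zero _ (by simp)
    refine mul_left_cancel₀ hneg ?_
    have hcancel : S.eps r r x * (S.eps r r x)⁻¹ = 1 := mul_inv_cancel₀ hx
    simp only [div_eq_mul_inv] at hstar hy ⊢
    linear_combination -hy + hstar + (c : ℂ) * hw + ((c : ℂ) - 1) * (S.eps r r x)⁻¹ * hz +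
      ((c : ℂ) - 1) * S.star (r + 1) (r + 1 + m) x * hcancel

end EpsSystem

end EpsSys

open EpsSys

/-- in an `A_n` epsilon system, for every interval `[s,t]` with `s ≥ 2`,
every `x` with `ε_{s−1}(x) ≠ 0` and every `c ∈ ℂˣ`:
`ε_{[s,t]}(e_{s−1}^c x) = c·ε_{[s,t]}(x) + (1−c) ε_{[s−1,t]}(x)/ε_{s−1}(x)` and
`ε*_{[s,t]}(e_{s−1}^c x) = ε*_{[s,t]}(x) + (c−1) ε*_{[s−1,t]}(x)/ε_{s−1}(x)`. -/
theorem stmt3 (n : ℕ) (hn : 1 ≤ n) {X : Type*} (S : EpsSystem n X)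
    (s t : ℕ) (hs : 2 ≤ s) (hst : s ≤ t) (ht : t ≤ n)
    (x : X) (hx : S.eps (s - 1) (s - 1) x ≠ 0) (c : ℂˣ) :
    S.eps s t (S.act (s - 1) c x)
      = (c : ℂ) * S.eps s t x + (1 - (c : ℂ)) * S.eps (s - 1) t x / S.eps (s - 1) (s - 1) x ∧
    S.star s t (S.act (s - 1) c x)
      = S.star s t x + ((c : ℂ) - 1) * S.star (s - 1) t x / S.eps (s - 1) (s - 1) x := by
  obtain ⟨r, rfl⟩ : ∃ r, s = r + 1 := ⟨s - 1, by omega⟩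
  obtain ⟨m, rfl⟩ := Nat.exists_eq_add_of_le hst
  rw [Nat.add_sub_cancel] at hx ⊢
  exact ⟨S.eps_act_pred (by omega) hx c m ht, S.star_act_pred (by omega) ht hx c⟩
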